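/- arXiv:1910.13178 — 2 statements merged into one kernel-verified Lean document; each statement's English description precedes it below -/
import Mathlib

section
/- Suppose the hiding distribution h satisfies liminf_{ε→0⁺} h([λ₁−ε, λ₁])/ε > 0 and liminf_{ε→0⁺} h([−λ₂, −λ₂+ε])/ε > 0 (h is leafy at both leaf nodes λ₁ and −λ₂). Then every search that is optimal for h is terminating. -/
open MeasureTheory Set Filter
open scoped ENNReal

noncomputable section

/-- A search of the interval network `Q = [-l₂, l₁]` with root `0`:
a 1-Lipschitz function on `[0,∞)` taking values in `Q` and starting at the root. -/
def IsSearch (l₁ l₂ : ℝ) (S : ℝ → ℝ) : Prop :=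
  S 0 = 0 ∧ (∀ t, 0 ≤ t → S t ∈ Icc (-l₂) l₁) ∧
    (∀ s t, 0 ≤ s → 0 ≤ t → |S s - S t| ≤ |s - t|)

/-- The search time `T(S,x) = inf {t ≥ 0 : S t = x}`, with value `∞` if `x` is never reached. -/
def searchTime (S : ℝ → ℝ) (x : ℝ) : ℝ≥0∞ :=
  sInf (ENNReal.ofReal '' {t : ℝ | 0 ≤ t ∧ S t = x})

/-- The expected search time `T(S,h) = ∫_Q T(S,x) dh(x)`. -/
def expTime (S : ℝ → ℝ) (h : Measure ℝ) : ℝ≥0∞ :=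
  ∫⁻ x, searchTime S x ∂h


/-- A search is terminating if it covers the whole interval by some finite time. -/
def Terminating (l₁ l₂ : ℝ) (S : ℝ → ℝ) : Prop :=
  ∃ M : ℝ, 0 ≤ M ∧ S '' Icc 0 M = Icc (-l₂) l₁

/-- A 1-Lipschitz path on `[0,∞)` with values in `[-l₂, l₁]` and starting at `p`. -/
def IsPath (l₁ l₂ p : ℝ) (S : ℝ → ℝ) : Prop :=
  S 0 = p ∧ (∀ t, 0 ≤ t → S t ∈ Icc (-l₂) l₁) ∧
    (∀ s t, 0 ≤ s → 0 ≤ t → |S s - S t| ≤ |s - t|)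

/-- Follow `S` up to time `s`, then follow `g`. -/
def concatPath (S : ℝ → ℝ) (s : ℝ) (g : ℝ → ℝ) (t : ℝ) : ℝ :=
  if t ≤ s then S t else g (t - s)

/-- The measure `h` charges the intervals `[l - ε, l]` at least proportionally to `ε`. -/
def LeafyAt (h : Measure ℝ) (l : ℝ) : Prop :=
  ∃ c : ℝ≥0∞, 0 < c ∧ ∃ δ : ℝ, 0 < δ ∧
    ∀ ε, 0 < ε → ε < δ → c * ENNReal.ofReal ε ≤ h (Icc (l - ε) l)

section

variable {l₁ l₂ p : ℝ} {S g : ℝ → ℝ}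

theorem IsSearch.isPath (hS : IsSearch l₁ l₂ S) : IsPath l₁ l₂ 0 S := hS

theorem concatPath_of_le {s t : ℝ} (ht : t ≤ s) : concatPath S s g t = S t := if_pos ht

theorem concatPath_add {s u : ℝ} (hg : g 0 = S s) (hu : 0 ≤ u) :
    concatPath S s g (s + u) = g u := by
  unfold concatPath
  split_ifs with h
  · have : u = 0 := by linarith
    simp [this, hg]
  · simp

theorem IsPath.concatPath (hS : IsPath l₁ l₂ p S) {s : ℝ} (hs : 0 ≤ s)
    (hg : IsPath l₁ l₂ (S s) g) : IsPath l₁ l₂ p (concatPath S s g) := by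
  obtain ⟨h0, hr, hL⟩ := hS
  obtain ⟨g0, gr, gL⟩ := hg
  refine ⟨by rw [concatPath_of_le hs, h0], fun t ht => ?_, ?_⟩
  · unfold _root_.concatPath
    split_ifs with h
    · exact hr t ht
    · exact gr _ (by linarith)
  · have key : ∀ a b, 0 ≤ a → a ≤ b →
        |_root_.concatPath S s g a - _root_.concatPath S s g b| ≤ |a - b| := by
      intro a b ha hab
      unfold _root_.concatPath
      split_ifs with h1 h2 h2
      · exact hL a b ha (by linarith)
      · have e1 := hL a s ha hs
        have e2 := gL 0 (b - s) le_rfl (by linarith)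
        rw [g0] at e2
        rw [abs_of_nonpos (by linarith : a - s ≤ 0)] at e1
        rw [abs_of_nonpos (by linarith : 0 - (b - s) ≤ 0)] at e2
        rw [abs_of_nonpos (by linarith : a - b ≤ 0)]
        have := abs_sub_le (S a) (S s) (g (b - s))
        linarith
      · linarith
      · have := gL (a - s) (b - s) (by linarith) (by linarith)
        simpa using this
    intro a b ha hb
    rcases le_total a b with hab | hab
    · exact key a b ha hab
    · rw [abs_sub_comm, abs_sub_comm a b]
      exact key b a hb hab

theorem IsPath.shift (hS : IsPath l₁ l₂ p S) {s : ℝ} (hs : 0 ≤ s) :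
    IsPath l₁ l₂ (S s) (fun t => S (s + t)) := by
  refine ⟨by simp, fun t ht => hS.2.1 _ (by linarith), fun a b ha hb => ?_⟩
  simpa using hS.2.2 (s + a) (s + b) (by linarith) (by linarith)

theorem IsPath.continuousOn (hS : IsPath l₁ l₂ p S) : ContinuousOn S (Ici 0) := by
  have : LipschitzOnWith 1 S (Ici 0) := LipschitzOnWith.of_dist_le_mul fun a ha b hb => by
    simpa [Real.dist_eq] using hS.2.2 a b ha hb
  exact this.continuousOn

theorem searchTime_le {t x : ℝ} (ht : 0 ≤ t) (hx : S t = x) :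
    searchTime S x ≤ ENNReal.ofReal t :=
  sInf_le ⟨t, ⟨ht, hx⟩, rfl⟩

theorem searchTime_cases (hS : ContinuousOn S (Ici 0)) (x : ℝ) :
    (searchTime S x = ⊤ ∧ ∀ t, 0 ≤ t → S t ≠ x) ∨
      ∃ u, 0 ≤ u ∧ S u = x ∧ searchTime S x = ENNReal.ofReal u ∧
        ∀ t, 0 ≤ t → S t = x → u ≤ t := by
  have hEq : {t : ℝ | 0 ≤ t ∧ S t = x} = Ici 0 ∩ S ⁻¹' {x} := by
    ext t; simp
  rcases {t : ℝ | 0 ≤ t ∧ S t = x}.eq_empty_or_nonempty with he | hne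
  · left
    refine ⟨by simp [searchTime, he], fun t ht hx => ?_⟩
    have : t ∈ {t : ℝ | 0 ≤ t ∧ S t = x} := ⟨ht, hx⟩
    simp [he] at this
  · right
    have hc : IsClosed {t : ℝ | 0 ≤ t ∧ S t = x} := by
      rw [hEq]; exact hS.preimage_isClosed_of_isClosed isClosed_Ici isClosed_singleton
    have hl := hc.isLeast_csInf hne ⟨0, fun t ht => ht.1⟩
    refine ⟨_, hl.1.1, hl.1.2, ?_, fun t ht hx => hl.2 ⟨ht, hx⟩⟩
    refine le_antisymm (searchTime_le hl.1.1 hl.1.2) (le_sInf ?_)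
    rintro _ ⟨t, ht, rfl⟩
    exact ENNReal.ofReal_le_ofReal (hl.2 ht)

theorem measurable_searchTime (hS : ContinuousOn S (Ici 0)) : Measurable (searchTime S) := by
  refine measurable_of_Iic fun c => ?_
  rcases eq_or_ne c ⊤ with rfl | hc
  · simp
  · have : searchTime S ⁻¹' Iic c = S '' Icc 0 c.toReal := by
      ext x
      simp only [mem_preimage, mem_Iic, mem_image, mem_Icc]
      constructor
      · intro hx
        rcases searchTime_cases hS x with ⟨h, -⟩ | ⟨u, hu, hux, h, -⟩
        · rw [h] at hx; exact absurd (top_le_iff.1 hx) hc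
        · rw [h] at hx
          exact ⟨u, ⟨hu, (ENNReal.ofReal_le_iff_le_toReal hc).1 hx⟩, hux⟩
      · rintro ⟨u, ⟨hu, huc⟩, hux⟩
        exact (searchTime_le hu hux).trans ((ENNReal.ofReal_le_iff_le_toReal hc).2 huc)
    rw [this]
    exact ((isCompact_Icc.image_of_continuousOn
      (hS.mono Icc_subset_Ici_self)).isClosed).measurableSet

theorem LeafyAt.pos {h : Measure ℝ} {l y : ℝ} (hl : LeafyAt h l) (hy : y < l) :
    0 < h (Ioc y l) := by
  obtain ⟨c, hc, δ, hδ, H⟩ := hl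
  have h1 : 0 < min ((l - y) / 2) (δ / 2) := lt_min (by linarith) (by linarith)
  have h2 : min ((l - y) / 2) (δ / 2) < δ := (min_le_right _ _).trans_lt (by linarith)
  have h3 : min ((l - y) / 2) (δ / 2) ≤ (l - y) / 2 := min_le_left _ _
  refine lt_of_lt_of_le (ENNReal.mul_pos hc.ne' (ENNReal.ofReal_pos.2 h1).ne')
    ((H _ h1 h2).trans (measure_mono fun x hx => ⟨by linarith [hx.1], hx.2⟩))

theorem LeafyAt.exists_lt {h : Measure ℝ} {l y : ℝ} (hl : LeafyAt h l) (hy : y < l)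
    (hS : ContinuousOn S (Ici 0)) (hfin : expTime S h ≠ ⊤) : ∃ t, 0 ≤ t ∧ y < S t := by
  have hae := ae_lt_top (measurable_searchTime hS) hfin
  obtain ⟨x, hx, hxt⟩ :=
    ((frequently_ae_mem_iff.2 (hl.pos hy).ne').and_eventually hae).exists
  rcases searchTime_cases hS x with ⟨h, -⟩ | ⟨u, hu, hux, -, -⟩
  · simp [h] at hxt
  · exact ⟨u, hu, hux ▸ hx.1⟩

theorem leafyAt_of_liminf_pos {h : Measure ℝ} {l : ℝ}
    (H : 0 < Filter.liminf
      (fun ε : ℝ => h (Icc (l - ε) l) / ENNReal.ofReal ε) (nhdsWithin 0 (Ioi 0))) :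
    LeafyAt h l := by
  obtain ⟨c, hc, hcl⟩ := exists_between H
  have := eventually_lt_of_lt_liminf hcl
  rw [eventually_nhdsWithin_iff, Metric.eventually_nhds_iff] at this
  obtain ⟨δ, hδ, h2⟩ := this
  refine ⟨c, hc, δ, hδ, fun ε h0 h1 => ENNReal.mul_le_of_le_div (h2 ?_ h0).le⟩
  rw [Real.dist_eq, sub_zero, abs_of_pos h0]
  exact h1

/-- Some search has finite expected search time. -/
theorem exists_isSearch_expTime_ne_top (hl₁ : 0 < l₁) (hl₂ : 0 < l₂) (h : Measure ℝ)
    [IsProbabilityMeasure h] (hsupp : h (Icc (-l₂) l₁) = 1) :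
    ∃ S, IsSearch l₁ l₂ S ∧ expTime S h ≠ ⊤ := by
  refine ⟨fun t => max (-l₂) (l₁ - |t - l₁|), ⟨?_, fun t ht => ⟨le_max_left _ _, ?_⟩, ?_⟩, ?_⟩
  · simp [abs_of_pos hl₁, hl₂.le]
  · exact max_le (by linarith) (by linarith [abs_nonneg (t - l₁)])
  · intro s t _ _
    have e1 := abs_max_sub_max_le_max (-l₂) (l₁ - |s - l₁|) (-l₂) (l₁ - |t - l₁|)
    have e2 := abs_abs_sub_abs_le_abs_sub (s - l₁) (t - l₁)
    rw [sub_self, abs_zero, max_eq_right (a := (0 : ℝ)) (abs_nonneg _),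
      show l₁ - |s - l₁| - (l₁ - |t - l₁|) = -(|s - l₁| - |t - l₁|) by ring, abs_neg] at e1
    rw [sub_sub_sub_cancel_right] at e2
    exact e1.trans e2
  · have hae : ∀ᵐ x ∂h, x ∈ Icc (-l₂) l₁ := by
      rw [← prob_compl_eq_zero_iff measurableSet_Icc] at hsupp
      exact hsupp
    have hle : expTime (fun t => max (-l₂) (l₁ - |t - l₁|)) h ≤
        ∫⁻ _, ENNReal.ofReal (2 * l₁ + l₂) ∂h := by
      refine lintegral_mono_ae (hae.mono fun x hx => ?_)
      refine (searchTime_le (t := 2 * l₁ - x) (by linarith [hx.2]) ?_).trans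
        (ENNReal.ofReal_le_ofReal (by linarith [hx.1]))
      rw [abs_of_nonneg (by linarith [hx.2]), max_eq_right (by linarith [hx.1])]
      ring
    rw [lintegral_const, measure_univ, mul_one] at hle
    exact (hle.trans_lt ENNReal.ofReal_lt_top).ne

/-- If an optimal search visits the leaf `-l₂`, it also visits the leaf `l₁`. -/
theorem visits_of_visits_neg (hl₁ : 0 < l₁) (hl₂ : 0 < l₂) {h : Measure ℝ}
    (hleaf : LeafyAt h l₁) (hS : IsSearch l₁ l₂ S) (hfin : expTime S h ≠ ⊤)
    (hopt : ∀ S' : ℝ → ℝ, IsSearch l₁ l₂ S' → expTime S h ≤ expTime S' h)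
    (hneg : ∃ t, 0 ≤ t ∧ S t = -l₂) : ∃ t, 0 ≤ t ∧ S t = l₁ := by
  by_contra! hno
  obtain ⟨s, hs, hsl⟩ := hneg
  have hP := hS.isPath
  have hc := hP.continuousOn
  set g : ℝ → ℝ := fun u => min (u - l₂) l₁ with hg
  have hg0 : g 0 = S s := by simp [hg, hsl]; linarith
  have hgP : IsPath l₁ l₂ (S s) g := by
    refine ⟨hg0, fun t ht => ⟨le_min (by linarith) (by linarith), min_le_right _ _⟩,
      fun a b _ _ => ?_⟩
    simpa using abs_min_sub_min_le_max (a - l₂) l₁ (b - l₂) l₁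
  have hS' : IsPath l₁ l₂ 0 (concatPath S s g) := hP.concatPath hs hgP
  obtain ⟨m, hm, hmax⟩ := isCompact_Icc.exists_isMaxOn
    (nonempty_Icc.2 (by linarith : (0 : ℝ) ≤ s + l₁ + l₂)) (hc.mono Icc_subset_Ici_self)
  have hmax' : ∀ t, 0 ≤ t → t ≤ s + l₁ + l₂ → S t ≤ S m := fun t h1 h2 => hmax ⟨h1, h2⟩
  have hml : S m < l₁ := lt_of_le_of_ne (hP.2.1 m hm.1).2 (hno m hm.1)
  have htail : ∀ x ∈ Icc (-l₂) l₁,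
      searchTime (concatPath S s g) x ≤ ENNReal.ofReal (s + (x + l₂)) := by
    intro x hx
    refine searchTime_le (by linarith [hx.1]) ?_
    rw [concatPath_add hg0 (by linarith [hx.1])]
    simp [hg, hx.2]
  have hle : ∀ x, searchTime (concatPath S s g) x ≤ searchTime S x := by
    intro x
    rcases searchTime_cases hc x with ⟨h1, -⟩ | ⟨u, hu, hux, h1, -⟩
    · simp [h1]
    · rw [h1]
      rcases le_or_gt u s with hus | hus
      · exact searchTime_le hu (by rw [concatPath_of_le hus, hux])
      · have e := hP.2.2 u s hu hs
        rw [hux, hsl, abs_of_pos (by linarith : 0 < u - s)] at e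
        refine (htail x (hux ▸ hP.2.1 u hu)).trans (ENNReal.ofReal_le_ofReal ?_)
        linarith [le_abs_self (x - -l₂)]
  have hlt : ∀ x ∈ Ioc (S m) l₁, searchTime (concatPath S s g) x < searchTime S x := by
    intro x hx
    have hxQ : x ∈ Icc (-l₂) l₁ := ⟨((hP.2.1 m hm.1).1).trans hx.1.le, hx.2⟩
    refine (htail x hxQ).trans_lt ?_
    rcases searchTime_cases hc x with ⟨h1, -⟩ | ⟨u, hu, hux, h1, -⟩
    · simp [h1]
    · rw [h1]
      have hu' : s + l₁ + l₂ < u := by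
        by_contra! hcon
        have := hmax' u hu hcon
        linarith [hx.1]
      exact (ENNReal.ofReal_lt_ofReal_iff (by linarith)).2 (by linarith [hx.2])
  have hfin' : expTime (concatPath S s g) h ≠ ⊤ :=
    ((lintegral_mono hle).trans_lt hfin.lt_top).ne
  have := lintegral_strict_mono_of_ae_le_of_ae_lt_on (measurable_searchTime hc).aemeasurable
    hfin' (ae_of_all h hle) (hleaf.pos hml).ne' (ae_of_all h hlt)
  exact absurd (hopt _ hS') (not_le.2 this)

/-- The mass of the points not visited before time `n` tends to zero. -/
theorem tendsto_measure_unvisited {h : Measure ℝ} [IsProbabilityMeasure h]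
    (hS : ContinuousOn S (Ici 0)) (hfin : expTime S h ≠ ⊤) :
    Tendsto (fun n : ℕ => h (S '' Icc 0 (n : ℝ))ᶜ) atTop (nhds 0) := by
  have hae := ae_lt_top (measurable_searchTime hS) hfin
  have h0 : h (⋂ n : ℕ, (S '' Icc 0 (n : ℝ))ᶜ) = 0 := by
    refine measure_mono_null (fun x hx => ?_) (ae_iff.1 hae)
    simp only [mem_iInter] at hx
    rcases searchTime_cases hS x with ⟨h1, -⟩ | ⟨u, hu, hux, -, -⟩
    · simp [h1]
    · obtain ⟨n, hn⟩ := exists_nat_ge u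
      exact absurd ⟨u, ⟨hu, hn⟩, hux⟩ (hx n)
  rw [← h0]
  refine tendsto_measure_iInter_atTop (fun n => ?_) (fun m n hmn => ?_) ⟨0, measure_ne_top _ _⟩
  · exact (isCompact_Icc.image_of_continuousOn
      (hS.mono Icc_subset_Ici_self)).isClosed.measurableSet.compl.nullMeasurableSet
  · exact compl_subset_compl.2 (image_mono (Icc_subset_Icc_right (by exact_mod_cast hmn)))

/-- The gain and loss of inserting an excursion to the leaf `l₁` at time `s`, when the search
is at the running maximum `S s` and that maximum is not improved until after the search has
visited the other side of the root. -/
theorem mul_measure_le_of_excursion {h : Measure ℝ} (hS : IsSearch l₁ l₂ S)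
    (hfin : expTime S h ≠ ⊤)
    (hopt : ∀ S' : ℝ → ℝ, IsSearch l₁ l₂ S' → expTime S h ≤ expTime S' h)
    {t₀ s t₁ : ℝ} (ht₀ : 0 ≤ t₀) (hts : t₀ ≤ s) (hst : s ≤ t₁)
    (hmax : ∀ t, 0 ≤ t → t ≤ t₁ → S t ≤ S s) (ht₁ : S t₁ ≤ 0) :
    ENNReal.ofReal (S s) * h (Ioc (S s) l₁) ≤
      ENNReal.ofReal (2 * (l₁ - S s)) * h (S '' Icc 0 t₀)ᶜ := by
  have hs : 0 ≤ s := ht₀.trans hts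
  have hP := hS.isPath
  have hc := hP.continuousOn
  set ε := l₁ - S s with hε
  have hε0 : 0 ≤ ε := sub_nonneg.2 (hP.2.1 s hs).2
  have hR0 : 0 ≤ S s := by
    have := hmax 0 le_rfl (hs.trans hst)
    rwa [hP.1] at this
  set b : ℝ → ℝ := fun u => l₁ - min |u - ε| ε with hb
  have hb0 : b 0 = S s := by
    simp only [hb]
    rw [zero_sub, abs_neg, abs_of_nonneg hε0, min_self, hε]; ring
  have hb2 : b (2 * ε) = S s := by
    simp only [hb]
    rw [show 2 * ε - ε = ε by ring, abs_of_nonneg hε0, min_self, hε]; ring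
  have hbP : IsPath l₁ l₂ (S s) b := by
    refine ⟨hb0, fun t _ => ⟨?_, ?_⟩, fun x y _ _ => ?_⟩
    · have := (hP.2.1 s hs).1
      have := min_le_right |t - ε| ε
      simp only [hb]; linarith
    · have : 0 ≤ min |t - ε| ε := le_min (abs_nonneg _) hε0
      simp only [hb]; linarith
    · have e1 := abs_min_sub_min_le_max (|x - ε|) ε (|y - ε|) ε
      have e2 := abs_abs_sub_abs_le_abs_sub (x - ε) (y - ε)
      simp only [sub_self, abs_zero, sub_sub_sub_cancel_right] at e1 e2
      rw [max_eq_left (abs_nonneg _)] at e1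
      rw [show b x - b y = -(min |x - ε| ε - min |y - ε| ε) by simp only [hb]; ring, abs_neg]
      exact e1.trans e2
  set r : ℝ → ℝ := fun t => S (s + t) with hr
  have hrP : IsPath l₁ l₂ (b (2 * ε)) r := hb2 ▸ hP.shift hs
  have hr0 : r 0 = b (2 * ε) := hrP.1
  set g := concatPath b (2 * ε) r with hg
  have hgP : IsPath l₁ l₂ (S s) g := hbP.concatPath (by linarith) hrP
  set S' := concatPath S s g with hS'
  have hS'P : IsPath l₁ l₂ 0 S' := hP.concatPath hs hgP
  have hVm : MeasurableSet (S '' Icc 0 t₀)ᶜ := (isCompact_Icc.image_of_continuousOn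
      (hc.mono Icc_subset_Ici_self)).isClosed.measurableSet.compl
  have key : ∀ x, searchTime S' x +
      (Ioc (S s) l₁).indicator (fun _ => ENNReal.ofReal (S s)) x ≤
      searchTime S x + (S '' Icc 0 t₀)ᶜ.indicator (fun _ => ENNReal.ofReal (2 * ε)) x := by
    intro x
    rcases searchTime_cases hc x with ⟨h1, -⟩ | ⟨u, hu, hux, h1, hmin⟩
    · simp [h1]
    rw [h1]
    rcases le_or_gt x (S s) with hxR | hxR
    · rw [indicator_of_notMem (by simp [hxR]), add_zero]
      rcases le_or_gt u s with hus | hus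
      · exact (searchTime_le hu (by rw [hS', concatPath_of_le hus, hux])).trans le_self_add
      · have hxV : x ∈ (S '' Icc 0 t₀)ᶜ := by
          rintro ⟨t, ⟨h2, h3⟩, h4⟩
          linarith [hmin t h2 h4]
        rw [indicator_of_mem hxV, ← ENNReal.ofReal_add hu (by linarith)]
        refine searchTime_le (by linarith) ?_
        rw [show u + 2 * ε = s + (2 * ε + (u - s)) by ring, hS',
          concatPath_add hgP.1 (by linarith), hg, concatPath_add hr0 (by linarith)]
        simp [hr, hux]
    · have hxl : x ≤ l₁ := hux ▸ (hP.2.1 u hu).2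
      have hut : t₁ < u := by
        by_contra! hcon
        linarith [hmax u hu hcon]
      have e := hP.2.2 u t₁ hu (hs.trans hst)
      rw [hux, abs_of_pos (by linarith : 0 < u - t₁)] at e
      have e' := le_abs_self (x - S t₁)
      rw [indicator_of_mem (show x ∈ Ioc (S s) l₁ from ⟨hxR, hxl⟩)]
      refine le_trans ?_ le_self_add
      have h2 : searchTime S' x ≤ ENNReal.ofReal (s + (x - S s)) := by
        refine searchTime_le (by linarith) ?_
        rw [hS', concatPath_add hgP.1 (by linarith), hg, concatPath_of_le (by linarith)]
        simp only [hb]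
        rw [abs_of_nonpos (by linarith), min_eq_left (by linarith)]
        linarith
      refine (add_le_add_left h2 _).trans ?_
      rw [← ENNReal.ofReal_add (by linarith) hR0]
      exact ENNReal.ofReal_le_ofReal (by linarith)
  have hkey := lintegral_mono (μ := h) key
  rw [lintegral_add_right _ (measurable_const.indicator measurableSet_Ioc),
    lintegral_add_right _ (measurable_const.indicator hVm),
    lintegral_indicator_const measurableSet_Ioc, lintegral_indicator_const hVm] at hkey
  have h3 : expTime S h + ENNReal.ofReal (S s) * h (Ioc (S s) l₁) ≤
      expTime S h + ENNReal.ofReal (2 * ε) * h (S '' Icc 0 t₀)ᶜ :=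
    (add_le_add_left (hopt S' hS'P) _).trans hkey
  exact (ENNReal.add_le_add_iff_left hfin).1 h3

/-- An optimal search that gets arbitrarily close to the leaf `-l₂` without visiting it
visits the leaf `l₁`. -/
theorem visits_of_not_visits_neg (hl₁ : 0 < l₁) {h : Measure ℝ}
    [IsProbabilityMeasure h] (hleaf : LeafyAt h l₁)
    (hleft : ∀ y, -l₂ < y → ∃ t, 0 ≤ t ∧ S t < y) (hS : IsSearch l₁ l₂ S)
    (hfin : expTime S h ≠ ⊤)
    (hopt : ∀ S' : ℝ → ℝ, IsSearch l₁ l₂ S' → expTime S h ≤ expTime S' h)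
    (hneg : ∀ t, 0 ≤ t → S t ≠ -l₂) : ∃ t, 0 ≤ t ∧ S t = l₁ := by
  by_contra! hno
  have hP := hS.isPath
  have hc := hP.continuousOn
  obtain ⟨c, hc0, δ, hδ, hleafδ⟩ := id hleaf
  have hpos : 0 < ENNReal.ofReal (l₁ / 2) * c :=
    ENNReal.mul_pos (ENNReal.ofReal_pos.2 (by linarith)).ne' hc0.ne'
  have hev : ∀ᶠ n : ℕ in atTop,
      ENNReal.ofReal 4 * h (S '' Icc 0 (n : ℝ))ᶜ < ENNReal.ofReal (l₁ / 2) * c := by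
    have := ENNReal.Tendsto.const_mul (a := ENNReal.ofReal 4)
      (tendsto_measure_unvisited hc hfin) (Or.inr ENNReal.ofReal_ne_top)
    rw [mul_zero] at this
    exact this.eventually_lt_const hpos
  obtain ⟨a, ha, hal⟩ := hleaf.exists_lt
    (max_lt (by linarith : l₁ / 2 < l₁) (by linarith : l₁ - δ < l₁)) hc hfin
  obtain ⟨n, hn, hna⟩ := (hev.and (eventually_ge_atTop ⌈a⌉₊)).exists
  have han : a ≤ n := Nat.ceil_le.1 hna
  obtain ⟨m, hm, hmmax⟩ := isCompact_Icc.exists_isMaxOn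
    (nonempty_Icc.2 (Nat.cast_nonneg n : (0 : ℝ) ≤ n)) (hc.mono Icc_subset_Ici_self)
  have ham : S a ≤ S m := hmmax ⟨ha, han⟩
  obtain ⟨u, hu, hmu⟩ := hleaf.exists_lt
    (lt_of_le_of_ne (hP.2.1 m hm.1).2 (hno m hm.1)) hc hfin
  obtain ⟨k, hk, hkmin⟩ := isCompact_Icc.exists_isMinOn
    (nonempty_Icc.2 hu) (hc.mono Icc_subset_Ici_self)
  obtain ⟨t₁, ht₁, hkt⟩ := hleft (S k)
    (lt_of_le_of_ne (hP.2.1 k hk.1).1 (hneg k hk.1).symm)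
  have hut : u < t₁ := by
    by_contra! hcon
    have : S k ≤ S t₁ := hkmin ⟨ht₁, hcon⟩
    linarith
  have hk0 : S k ≤ 0 := by
    have : S k ≤ S 0 := hkmin ⟨le_rfl, hu⟩
    rwa [hP.1] at this
  obtain ⟨s, hs, hsmax⟩ := isCompact_Icc.exists_isMaxOn
    (nonempty_Icc.2 ht₁) (hc.mono Icc_subset_Ici_self)
  have hus : S u ≤ S s := hsmax ⟨hu, hut.le⟩
  have hns : (n : ℝ) ≤ s := by
    by_contra! hcon
    have : S s ≤ S m := hmmax ⟨hs.1, hcon.le⟩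
    linarith
  have hsl : S s < l₁ := lt_of_le_of_ne (hP.2.1 s hs.1).2 (hno s hs.1)
  have hexc := mul_measure_le_of_excursion hS hfin hopt (Nat.cast_nonneg n) hns hs.2
    (fun t h1 h2 => hsmax ⟨h1, h2⟩) (by linarith)
  have hRl : l₁ / 2 ≤ S s := by linarith [le_max_left (l₁ / 2) (l₁ - δ)]
  have hRδ : l₁ - δ ≤ S s := by linarith [le_max_right (l₁ / 2) (l₁ - δ)]
  set e := (l₁ - S s) / 2 with he
  have he0 : 0 < e := by linarith
  have hmass : c * ENNReal.ofReal e ≤ h (Ioc (S s) l₁) :=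
    (hleafδ e he0 (by linarith)).trans (measure_mono fun x hx => ⟨by linarith [hx.1], hx.2⟩)
  have hchain : ENNReal.ofReal (l₁ / 2) * c * ENNReal.ofReal e ≤
      ENNReal.ofReal 4 * h (S '' Icc 0 (n : ℝ))ᶜ * ENNReal.ofReal e := by
    calc ENNReal.ofReal (l₁ / 2) * c * ENNReal.ofReal e
        = ENNReal.ofReal (l₁ / 2) * (c * ENNReal.ofReal e) := mul_assoc _ _ _
      _ ≤ ENNReal.ofReal (S s) * h (Ioc (S s) l₁) :=
          mul_le_mul' (ENNReal.ofReal_le_ofReal hRl) hmass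
      _ ≤ ENNReal.ofReal (2 * (l₁ - S s)) * h (S '' Icc 0 (n : ℝ))ᶜ := hexc
      _ = ENNReal.ofReal 4 * h (S '' Icc 0 (n : ℝ))ᶜ * ENNReal.ofReal e := by
          rw [show 2 * (l₁ - S s) = 4 * e by rw [he]; ring,
            ENNReal.ofReal_mul (by norm_num)]
          ring
  have := (ENNReal.mul_le_mul_iff_left (ENNReal.ofReal_pos.2 he0).ne'
    ENNReal.ofReal_ne_top).1 hchain
  exact absurd hn (not_lt.2 this)

theorem IsSearch.neg (hS : IsSearch l₁ l₂ S) : IsSearch l₂ l₁ (fun t => -S t) := by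
  refine ⟨by simp [hS.1], fun t ht => ?_, fun a b ha hb => ?_⟩
  · obtain ⟨h1, h2⟩ := hS.2.1 t ht
    exact ⟨neg_le_neg h2, by linarith⟩
  · have := hS.2.2 a b ha hb
    rwa [neg_sub_neg, abs_sub_comm]

theorem expTime_neg (S : ℝ → ℝ) (h : Measure ℝ) :
    expTime (fun t => -S t) (h.map (MeasurableEquiv.neg ℝ)) = expTime S h := by
  unfold expTime
  rw [lintegral_map_equiv]
  simp [searchTime]

theorem visits_leaf (hl₁ : 0 < l₁) (hl₂ : 0 < l₂) {h : Measure ℝ} [IsProbabilityMeasure h]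
    (hleaf₁ : LeafyAt h l₁) (hleaf₂ : LeafyAt (h.map (MeasurableEquiv.neg ℝ)) l₂)
    (hS : IsSearch l₁ l₂ S) (hfin : expTime S h ≠ ⊤)
    (hopt : ∀ S' : ℝ → ℝ, IsSearch l₁ l₂ S' → expTime S h ≤ expTime S' h) :
    ∃ t, 0 ≤ t ∧ S t = l₁ := by
  by_cases hneg : ∃ t, 0 ≤ t ∧ S t = -l₂
  · exact visits_of_visits_neg hl₁ hl₂ hleaf₁ hS hfin hopt hneg
  · push Not at hneg
    refine visits_of_not_visits_neg hl₁ hleaf₁ (fun y hy => ?_) hS hfin hopt hneg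
    obtain ⟨t, ht, h1⟩ := hleaf₂.exists_lt (y := -y) (by linarith)
      hS.neg.isPath.continuousOn (by rwa [expTime_neg])
    exact ⟨t, ht, by linarith⟩

end

/-- If the hiding distribution is leafy at both leaf nodes (positive liminf density near
`l₁` and near `-l₂`), then every optimal search is terminating. -/
theorem optimal_of_leafy_terminating (l₁ l₂ : ℝ) (hl₁ : 0 < l₁) (hl₂ : 0 < l₂)
    (h : Measure ℝ) [IsProbabilityMeasure h] (hsupp : h (Icc (-l₂) l₁) = 1)
    (hleaf₁ : 0 < Filter.liminf
      (fun ε : ℝ => h (Icc (l₁ - ε) l₁) / ENNReal.ofReal ε) (nhdsWithin 0 (Ioi 0)))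
    (hleaf₂ : 0 < Filter.liminf
      (fun ε : ℝ => h (Icc (-l₂) (-l₂ + ε)) / ENNReal.ofReal ε) (nhdsWithin 0 (Ioi 0)))
    (S : ℝ → ℝ) (hS : IsSearch l₁ l₂ S)
    (hopt : ∀ S' : ℝ → ℝ, IsSearch l₁ l₂ S' → expTime S h ≤ expTime S' h) :
    Terminating l₁ l₂ S := by
  obtain ⟨S₀, hS₀, hfin₀⟩ := exists_isSearch_expTime_ne_top hl₁ hl₂ h hsupp
  have hfin : expTime S h ≠ ⊤ := ((hopt S₀ hS₀).trans_lt hfin₀.lt_top).ne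
  have hL₁ : LeafyAt h l₁ := leafyAt_of_liminf_pos hleaf₁
  have hL₂ : LeafyAt (h.map (MeasurableEquiv.neg ℝ)) l₂ := by
    refine leafyAt_of_liminf_pos ?_
    convert hleaf₂ using 4 with ε
    rw [MeasurableEquiv.map_apply]
    congr 1
    ext x
    simp only [MeasurableEquiv.neg_apply, mem_preimage, mem_Icc]
    constructor <;> rintro ⟨h1, h2⟩ <;> constructor <;> linarith
  have hL₁' : LeafyAt ((h.map (MeasurableEquiv.neg ℝ)).map (MeasurableEquiv.neg ℝ)) l₁ := by
    rw [Measure.map_map (MeasurableEquiv.neg ℝ).measurable (MeasurableEquiv.neg ℝ).measurable]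
    have : (MeasurableEquiv.neg ℝ : ℝ → ℝ) ∘ (MeasurableEquiv.neg ℝ) = id := by ext x; simp
    rwa [this, Measure.map_id]
  have hprob : IsProbabilityMeasure (h.map (MeasurableEquiv.neg ℝ)) :=
    Measure.isProbabilityMeasure_map (MeasurableEquiv.neg ℝ).measurable.aemeasurable
  obtain ⟨a, ha, haS⟩ := visits_leaf hl₁ hl₂ hL₁ hL₂ hS hfin hopt
  obtain ⟨b, hb, hbS⟩ := visits_leaf hl₂ hl₁ hL₂ hL₁' hS.neg (by rwa [expTime_neg])
    (fun S' hS' => by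
      rw [expTime_neg]
      have h1 := hopt _ hS'.neg
      rw [← expTime_neg (fun t => -S' t)] at h1
      simpa using h1)
  refine ⟨max a b, ha.trans (le_max_left _ _), Subset.antisymm ?_ ?_⟩
  · rintro _ ⟨t, ht, rfl⟩
    exact hS.2.1 t ht.1
  · have hpre : IsPreconnected (S '' Icc 0 (max a b)) := isPreconnected_Icc.image _
      (hS.isPath.continuousOn.mono Icc_subset_Ici_self)
    exact hpre.Icc_subset ⟨b, ⟨hb, le_max_right _ _⟩, by linarith⟩
      ⟨a, ⟨ha, le_max_left _ _⟩, haS⟩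

end
end

section
/- Suppose the hiding distribution h on Q is balanced and h({0}) = 0, and set h₁ = h((0,λ₁]) and h₂ = h([−λ₂,0)). Then the expected search time of any depth-first search is T(S⁺,h) = T(S⁻,h) = μ(1 − h₁² − h₂²) + ∫_Q |x| dh(x), where ∫_Q |x| dh(x) is the mean distance of the target from the root. -/
open MeasureTheory Set Filter
open scoped ENNReal

noncomputable section

/-- The depth-first search `S⁺`: unit speed from `0` to `l₁`, then to `-l₂`, then rests. -/
def Splus (l₁ l₂ : ℝ) (t : ℝ) : ℝ :=
  if t ≤ l₁ then t else if t ≤ 2 * l₁ + l₂ then 2 * l₁ - t else -l₂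

/-- The depth-first search `S⁻`: unit speed from `0` to `-l₂`, then to `l₁`, then rests. -/
def Sminus (l₁ l₂ : ℝ) (t : ℝ) : ℝ :=
  if t ≤ l₂ then -t else if t ≤ 2 * l₂ + l₁ then t - 2 * l₂ else l₁

/-- A hiding distribution is balanced if the two branches at the root have equal search
density: `λ₂ · h((0,λ₁]) = λ₁ · h([-λ₂,0))`. -/
def BalancedDist (l₁ l₂ : ℝ) (h : Measure ℝ) : Prop :=
  l₂ * (h (Ioc 0 l₁)).toReal = l₁ * (h (Ico (-l₂) 0)).toReal

theorem searchTime_eq_ofReal {S : ℝ → ℝ} {x T : ℝ} (hT : 0 ≤ T) (hST : S T = x)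
    (hmin : ∀ t, 0 ≤ t → S t = x → T ≤ t) : searchTime S x = ENNReal.ofReal T := by
  apply le_antisymm
  · exact sInf_le ⟨T, ⟨hT, hST⟩, rfl⟩
  · apply le_sInf
    rintro _ ⟨t, ⟨ht, hSt⟩, rfl⟩
    exact ENNReal.ofReal_le_ofReal (hmin t ht hSt)

theorem searchTime_Splus {l₁ l₂ x : ℝ} (hl₁ : 0 < l₁) (hx : x ∈ Icc (-l₂) l₁) :
    searchTime (Splus l₁ l₂) x =
      ENNReal.ofReal |x| + (Ico (-l₂) 0).indicator (fun _ => ENNReal.ofReal (2 * l₁)) x := by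
  obtain ⟨hx₁, hx₂⟩ := hx
  rcases lt_or_ge x 0 with hneg | hpos
  · rw [indicator_of_mem (show x ∈ Ico (-l₂) 0 from ⟨hx₁, hneg⟩),
      ← ENNReal.ofReal_add (abs_nonneg x) (by linarith), abs_of_neg hneg]
    refine searchTime_eq_ofReal (by linarith) ?_ fun t ht hSt => ?_
    · rw [Splus, if_neg (by linarith), if_pos (by linarith)]
      ring
    · unfold Splus at hSt
      split_ifs at hSt <;> linarith
  · rw [indicator_of_notMem (fun hmem => not_lt.mpr hpos hmem.2), add_zero, abs_of_nonneg hpos]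
    refine searchTime_eq_ofReal hpos ?_ fun t ht hSt => ?_
    · rw [Splus, if_pos hx₂]
    · unfold Splus at hSt
      split_ifs at hSt <;> linarith

theorem searchTime_Sminus {l₁ l₂ x : ℝ} (hl₂ : 0 < l₂) (hx : x ∈ Icc (-l₂) l₁) :
    searchTime (Sminus l₁ l₂) x =
      ENNReal.ofReal |x| + (Ioc 0 l₁).indicator (fun _ => ENNReal.ofReal (2 * l₂)) x := by
  obtain ⟨hx₁, hx₂⟩ := hx
  rcases lt_or_ge 0 x with hpos | hneg
  · rw [indicator_of_mem (show x ∈ Ioc 0 l₁ from ⟨hpos, hx₂⟩),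
      ← ENNReal.ofReal_add (abs_nonneg x) (by linarith), abs_of_pos hpos]
    refine searchTime_eq_ofReal (by linarith) ?_ fun t ht hSt => ?_
    · rw [Sminus, if_neg (by linarith), if_pos (by linarith)]
      ring
    · unfold Sminus at hSt
      split_ifs at hSt <;> linarith
  · rw [indicator_of_notMem (fun hmem => not_lt.mpr hneg hmem.1), add_zero, abs_of_nonpos hneg]
    refine searchTime_eq_ofReal (by linarith) ?_ fun t ht hSt => ?_
    · rw [Sminus, if_pos (by linarith), neg_neg]
    · unfold Sminus at hSt
      split_ifs at hSt <;> linarith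

theorem expTime_eq_of_searchTime_ae_eq {h : Measure ℝ} [IsFiniteMeasure h] {S : ℝ → ℝ}
    {s : Set ℝ} {c : ℝ} (hs : MeasurableSet s) (hc : 0 ≤ c)
    (hint : Integrable (fun x : ℝ => |x|) h)
    (hS : ∀ᵐ x ∂h, searchTime S x =
      ENNReal.ofReal |x| + s.indicator (fun _ => ENNReal.ofReal c) x) :
    expTime S h = ENNReal.ofReal (c * (h s).toReal + ∫ x, |x| ∂h) := by
  rw [expTime, lintegral_congr_ae hS, lintegral_add_left (by fun_prop),
    lintegral_indicator_const hs,
    ← ofReal_integral_eq_lintegral_ofReal hint (ae_of_all _ abs_nonneg), add_comm,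
    ENNReal.ofReal_add (by positivity) (integral_nonneg abs_nonneg), ENNReal.ofReal_mul hc,
    ENNReal.ofReal_toReal (measure_ne_top h s)]

theorem measure_Ioc_add_measure_Ico {l₁ l₂ : ℝ} (hl₁ : 0 < l₁) (hl₂ : 0 < l₂) {h : Measure ℝ}
    [IsProbabilityMeasure h] (hsupp : h (Icc (-l₂) l₁) = 1) (hroot : h {0} = 0) :
    (h (Ioc 0 l₁)).toReal + (h (Ico (-l₂) 0)).toReal = 1 := by
  have hsplit : Ico (-l₂) 0 ∪ Icc 0 l₁ = Icc (-l₂) l₁ :=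
    Ico_union_Icc_eq_Icc (by linarith) hl₁.le
  have hdisj : Disjoint (Ico (-l₂) 0) (Icc 0 l₁) :=
    Set.disjoint_left.mpr fun x hx hx' => not_lt.mpr hx'.1 hx.2
  have hIcc : h (Icc 0 l₁) = h (Ioc 0 l₁) := by
    rw [← Icc_sdiff_left, measure_sdiff_null hroot]
  rw [← ENNReal.toReal_add (measure_ne_top _ _) (measure_ne_top _ _), ← hIcc, add_comm,
    ← measure_union hdisj measurableSet_Icc, hsplit, hsupp, ENNReal.toReal_one]

/-- For a balanced atomless-at-the-root distribution on a two-arc star, the expected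
search time of any depth-first search is `μ(1 - h₁² - h₂²) + ∫_Q |x| dh(x)`. -/
theorem DF_time_star_formula (l₁ l₂ : ℝ) (hl₁ : 0 < l₁) (hl₂ : 0 < l₂)
    (h : Measure ℝ) [IsProbabilityMeasure h] (hsupp : h (Icc (-l₂) l₁) = 1)
    (hroot : h {0} = 0) (hbal : BalancedDist l₁ l₂ h) :
    expTime (Splus l₁ l₂) h
        = ENNReal.ofReal ((l₁ + l₂) *
            (1 - (h (Ioc 0 l₁)).toReal ^ 2 - (h (Ico (-l₂) 0)).toReal ^ 2)
          + ∫ x, |x| ∂h) ∧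
      expTime (Sminus l₁ l₂) h
        = ENNReal.ofReal ((l₁ + l₂) *
            (1 - (h (Ioc 0 l₁)).toReal ^ 2 - (h (Ico (-l₂) 0)).toReal ^ 2)
          + ∫ x, |x| ∂h) := by
  have hsum := measure_Ioc_add_measure_Ico hl₁ hl₂ hsupp hroot
  have hae : ∀ᵐ x ∂h, x ∈ Icc (-l₂) l₁ := (mem_ae_iff_prob_eq_one measurableSet_Icc).mpr hsupp
  have hint : Integrable (fun x : ℝ => |x|) h := by
    refine Integrable.of_bound (by fun_prop) (l₁ + l₂) (hae.mono fun x hx => ?_)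
    rw [Real.norm_eq_abs, abs_abs, abs_le]
    constructor <;> linarith [hx.1, hx.2]
  rw [BalancedDist] at hbal
  rw [expTime_eq_of_searchTime_ae_eq measurableSet_Ico (by linarith) hint
      (hae.mono fun x hx => searchTime_Splus hl₁ hx),
    expTime_eq_of_searchTime_ae_eq measurableSet_Ioc (by linarith) hint
      (hae.mono fun x hx => searchTime_Sminus hl₂ hx)]
  generalize (h (Ioc 0 l₁)).toReal = a at *
  generalize (h (Ico (-l₂) 0)).toReal = b at *
  obtain rfl : b = 1 - a := by linarith
  constructor <;> congr 2
  · linear_combination (-2 * (1 - a)) * hbal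
  · linear_combination (2 * a) * hbal

end
end
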